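/- arXiv:math/0404253 — 3 statements merged into one kernel-verified Lean document; each statement's English description precedes it below -/
import Mathlib

section
/- The generating function for the number of irreducible ordered pairs of compositions satisfies, for every complex number z with |z| < 1/4, the identity ∑_{n≥1} f(n) z^n = z / (√(1−4z) + z), where the square root is the principal branch (note Re(1−4z) > 0 on this disk) and the series converges absolutely. -/
/-- `b : Fin k → ℕ` is a composition of `n` into `k` (positive) parts. -/
def IsComposition (n k : ℕ) (b : Fin k → ℕ) : Prop :=
  (∀ i, 0 < b i) ∧ ∑ i, b i = n

/-- An ordered pair of compositions of `n` into `k` parts is irreducible if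
their partial sums disagree at every index `j = 1, …, k-1`. -/
def IsIrreduciblePair (n k : ℕ) (b b' : Fin k → ℕ) : Prop :=
  IsComposition n k b ∧ IsComposition n k b' ∧
    ∀ j : ℕ, 1 ≤ j → j < k →
      ∑ i ∈ Finset.univ.filter (fun i : Fin k => (i : ℕ) < j), b i ≠
        ∑ i ∈ Finset.univ.filter (fun i : Fin k => (i : ℕ) < j), b' i

/-- `f n` is the number of irreducible ordered pairs of compositions of `n`
into the same number of parts (summed over all numbers of parts `k`). -/
noncomputable def numIrreduciblePairs (n : ℕ) : ℕ :=
  Nat.card {p : Σ k : ℕ, (Fin k → ℕ) × (Fin k → ℕ) //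
    IsIrreduciblePair n p.1 p.2.1 p.2.2}

theorem factorial_mul_centralBinom_eq_descPochhammer_smeval (n : ℕ) :
    (n.factorial : ℂ) * n.centralBinom =
      (descPochhammer ℤ n).smeval (-(1 / 2) : ℂ) * (-4) ^ n := by
  induction n with
  | zero => simp
  | succ n ih =>
    have h : ((n : ℂ) + 1) * (n + 1).centralBinom = 2 * (2 * n + 1) * n.centralBinom := by
      exact_mod_cast n.succ_mul_centralBinom_succ
    rw [descPochhammer_succ_right, Polynomial.smeval_mul, Polynomial.smeval_sub,
      Polynomial.smeval_X, Polynomial.smeval_natCast, Nat.factorial_succ]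
    push_cast
    simp only [pow_one, pow_zero, nsmul_eq_mul, mul_one]
    linear_combination (n.factorial : ℂ) * h + 2 * (2 * (n : ℂ) + 1) * ih

theorem ringChoose_neg_half_mul_neg_four_pow (n : ℕ) :
    Ring.choose (-(1 / 2) : ℂ) n * (-4) ^ n = n.centralBinom := by
  have h := factorial_mul_centralBinom_eq_descPochhammer_smeval n
  rw [Ring.descPochhammer_eq_factorial_smul_choose, nsmul_eq_mul, mul_assoc] at h
  exact (mul_left_cancel₀ (by exact_mod_cast n.factorial_ne_zero) h).symm

theorem hasSum_centralBinom_mul_pow {z : ℂ} (hz : ‖z‖ < 1 / 4) :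
    HasSum (fun n : ℕ => (n.centralBinom : ℂ) * z ^ n) ((1 - 4 * z) ^ (-(1 / 2) : ℂ)) := by
  have h4 : -4 * z ∈ Metric.eball (0 : ℂ) 1 := by
    rw [← ENNReal.ofReal_one, Metric.eball_ofReal]
    simp only [mem_ball_zero_iff, norm_mul, norm_neg]
    norm_num
    linarith
  have h := (Complex.one_add_cpow_hasFPowerSeriesOnBall_zero (a := -(1 / 2))).hasSum h4
  simp only [zero_add, binomialSeries_apply, List.ofFn_const, List.prod_replicate] at h
  rw [sub_eq_add_neg, ← neg_mul]
  refine h.congr_fun fun n => ?_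
  rw [← ringChoose_neg_half_mul_neg_four_pow, mul_pow, smul_eq_mul, mul_assoc]


/-- `l` lists the pairs of corresponding parts of two compositions of `n`. -/
def IsCompositionPairList (n : ℕ) (l : List (ℕ × ℕ)) : Prop :=
  (∀ p ∈ l, 0 < p.1 ∧ 0 < p.2) ∧ (l.map Prod.fst).sum = n ∧ (l.map Prod.snd).sum = n

/-- `l` lists the pairs of corresponding parts of an irreducible pair of compositions of `n`. -/
def IsIrreduciblePairList (n : ℕ) (l : List (ℕ × ℕ)) : Prop :=
  IsCompositionPairList n l ∧ ∀ j : ℕ, 1 ≤ j → j < l.length →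
    ((l.take j).map Prod.fst).sum ≠ ((l.take j).map Prod.snd).sum

/-- The number of pairs of compositions of `n` into the same number of parts. -/
noncomputable def numCompositionPairs (n : ℕ) : ℕ :=
  Nat.card {l : List (ℕ × ℕ) // IsCompositionPairList n l}

/-- Pairs of tuples of the same length are the same as lists of pairs. -/
def sigmaTuplePairEquivList : (Σ k : ℕ, (Fin k → ℕ) × (Fin k → ℕ)) ≃ List (ℕ × ℕ) :=
  (Equiv.sigmaCongrRight fun _ => (Equiv.arrowProdEquivProdArrow _ _ _).symm).trans
    List.equivSigmaTuple.symm

theorem sigmaTuplePairEquivList_apply (p : Σ k : ℕ, (Fin k → ℕ) × (Fin k → ℕ)) :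
    sigmaTuplePairEquivList p = List.ofFn fun i => (p.2.1 i, p.2.2 i) :=
  rfl

theorem isCompositionPairList_sigmaTuplePairEquivList {n : ℕ}
    (p : Σ k : ℕ, (Fin k → ℕ) × (Fin k → ℕ)) :
    IsCompositionPairList n (sigmaTuplePairEquivList p) ↔
      IsComposition n p.1 p.2.1 ∧ IsComposition n p.1 p.2.2 := by
  simp only [IsCompositionPairList, IsComposition, sigmaTuplePairEquivList_apply,
    List.forall_mem_ofFn_iff, List.map_ofFn, List.sum_ofFn, Function.comp_apply, forall_and]
  tauto

theorem isIrreduciblePairList_sigmaTuplePairEquivList {n : ℕ}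
    (p : Σ k : ℕ, (Fin k → ℕ) × (Fin k → ℕ)) :
    IsIrreduciblePairList n (sigmaTuplePairEquivList p) ↔
      IsIrreduciblePair n p.1 p.2.1 p.2.2 := by
  rw [IsIrreduciblePairList, isCompositionPairList_sigmaTuplePairEquivList, IsIrreduciblePair,
    and_assoc]
  simp only [sigmaTuplePairEquivList_apply, List.map_take, List.map_ofFn, List.sum_take_ofFn,
    List.length_ofFn, Function.comp_apply]

theorem numIrreduciblePairs_eq_card_list (n : ℕ) :
    numIrreduciblePairs n = Nat.card {l : List (ℕ × ℕ) // IsIrreduciblePairList n l} :=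
  Nat.card_congr <| sigmaTuplePairEquivList.subtypeEquiv fun p =>
    (isIrreduciblePairList_sigmaTuplePairEquivList p).symm

/-- The finite set of compositions of `n` into `k` parts. -/
def compositionFinset (n k : ℕ) : Finset (Fin k → ℕ) :=
  (Finset.piAntidiag Finset.univ n).filter fun b => ∀ i, 0 < b i

theorem mem_compositionFinset {n k : ℕ} {b : Fin k → ℕ} :
    b ∈ compositionFinset n k ↔ IsComposition n k b := by
  simp [compositionFinset, IsComposition, and_comm]

theorem IsComposition.le {n k : ℕ} {b : Fin k → ℕ} (h : IsComposition n k b) : k ≤ n := by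
  rw [← h.2]
  simpa using Finset.card_nsmul_le_sum Finset.univ b 1 fun i _ => h.1 i

theorem card_compositionFinset_succ {m j : ℕ} (hj : j ≤ m) :
    (compositionFinset (m + 1) (j + 1)).card = m.choose j := by
  have h := Finset.card_finsuppAntidiag_nat_eq_choose
    (s := (Finset.univ : Finset (Fin (j + 1)))) (m - j)
  rw [Finset.card_univ, Fintype.card_fin, show j + 1 + (m - j) - 1 = m by lia,
    Nat.choose_symm hj] at h
  rw [← h]
  refine Finset.card_bij' (fun b _ => Finsupp.equivFunOnFinite.symm fun i => b i - 1)
    (fun b _ i => b i + 1) ?_ ?_ ?_ ?_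
  · intro b hb
    rw [mem_compositionFinset] at hb
    have h1 : ∑ i, (b i - 1 + 1) = m + 1 := by
      rw [← hb.2]
      exact Finset.sum_congr rfl fun i _ => Nat.sub_add_cancel (hb.1 i)
    rw [Finset.sum_add_distrib] at h1
    simp at h1
    simp [Finset.mem_finsuppAntidiag]
    lia
  · intro b hb
    simp [Finset.mem_finsuppAntidiag] at hb
    simp [mem_compositionFinset, IsComposition, Finset.sum_add_distrib, hb]
    lia
  · intro b hb
    rw [mem_compositionFinset] at hb
    ext i
    simp [Nat.sub_add_cancel (hb.1 i)]
  · intro b hb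
    ext i
    simp

/-- Lists of pairs of parts, as a finite union of products of sets of compositions. -/
noncomputable def compositionPairListEquiv (n : ℕ) :
    {l : List (ℕ × ℕ) // IsCompositionPairList n l} ≃
      ↥((Finset.range (n + 1)).sigma fun k =>
        compositionFinset n k ×ˢ compositionFinset n k) :=
  (sigmaTuplePairEquivList.subtypeEquiv fun p => by
    rw [isCompositionPairList_sigmaTuplePairEquivList, Finset.mem_sigma, Finset.mem_product,
      mem_compositionFinset, mem_compositionFinset, Finset.mem_range]
    exact ⟨fun h => h.2, fun h => ⟨Nat.lt_succ_of_le h.1.le, h⟩⟩).symm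

instance (n : ℕ) : Finite {l : List (ℕ × ℕ) // IsCompositionPairList n l} :=
  .of_equiv _ (compositionPairListEquiv n).symm

instance (n : ℕ) : Finite {l : List (ℕ × ℕ) // IsIrreduciblePairList n l} :=
  Finite.of_injective _ (Subtype.impEmbedding _ (IsCompositionPairList n) fun _ h => h.1).injective

theorem numCompositionPairs_eq_sum (n : ℕ) :
    numCompositionPairs n =
      ∑ k ∈ Finset.range (n + 1), (compositionFinset n k).card ^ 2 := by
  rw [numCompositionPairs, Nat.card_congr (compositionPairListEquiv n), Nat.card_eq_fintype_card,
    Fintype.card_coe, Finset.card_sigma]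
  simp only [Finset.card_product, sq]

theorem numCompositionPairs_zero : numCompositionPairs 0 = 1 := by
  rw [numCompositionPairs_eq_sum]
  simp [compositionFinset]

theorem numCompositionPairs_succ (m : ℕ) : numCompositionPairs (m + 1) = m.centralBinom := by
  rw [numCompositionPairs_eq_sum, Finset.sum_range_succ', Nat.centralBinom_eq_two_mul_choose,
    ← Nat.sum_range_choose_sq]
  have h0 : compositionFinset (m + 1) 0 = ∅ := by simp [compositionFinset]
  rw [h0, Finset.card_empty, zero_pow two_ne_zero, add_zero]
  refine Finset.sum_congr rfl fun j hj => ?_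
  rw [card_compositionFinset_succ (by simpa [Nat.lt_succ_iff] using hj)]

theorem IsCompositionPairList.append {m n : ℕ} {l₁ l₂ : List (ℕ × ℕ)}
    (h₁ : IsCompositionPairList m l₁) (h₂ : IsCompositionPairList n l₂) :
    IsCompositionPairList (m + n) (l₁ ++ l₂) := by
  refine ⟨fun p hp => ?_, ?_, ?_⟩
  · exact (List.mem_append.1 hp).elim (h₁.1 p) (h₂.1 p)
  · simp [h₁.2.1, h₂.2.1]
  · simp [h₁.2.2, h₂.2.2]

theorem IsCompositionPairList.ne_nil {n : ℕ} {l : List (ℕ × ℕ)}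
    (h : IsCompositionPairList (n + 1) l) : l ≠ [] := by
  rintro rfl
  simpa using h.2.1

/-- No irreducible list is a proper nonempty initial segment of another one. -/
theorem IsIrreduciblePairList.length_le_of_append_eq {m m' : ℕ} {l₁ l₂ l₁' l₂' : List (ℕ × ℕ)}
    (h : IsIrreduciblePairList (m + 1) l₁) (h' : IsIrreduciblePairList m' l₁')
    (heq : l₁ ++ l₂ = l₁' ++ l₂') : l₁'.length ≤ l₁.length := by
  by_contra! hlt
  refine h'.2 l₁.length (List.length_pos_iff.2 h.1.ne_nil) hlt ?_
  have : l₁'.take l₁.length = l₁ := by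
    rw [← List.take_append_of_le_length (l₂ := l₂') hlt.le, ← heq, List.take_left]
  rw [this, h.1.2.1, h.1.2.2]

/-- Every nonempty list of pairs of parts begins with an irreducible list. -/
theorem IsCompositionPairList.exists_append {n : ℕ} {l : List (ℕ × ℕ)}
    (h : IsCompositionPairList (n + 1) l) :
    ∃ i j l₁ l₂, i + j = n ∧ IsIrreduciblePairList (i + 1) l₁ ∧ IsCompositionPairList j l₂ ∧
      l₁ ++ l₂ = l := by
  classical
  have hex : ∃ j, 1 ≤ j ∧ ((l.take j).map Prod.fst).sum = ((l.take j).map Prod.snd).sum :=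
    ⟨l.length, List.length_pos_iff.2 h.ne_nil, by rw [List.take_length, h.2.1, h.2.2]⟩
  obtain ⟨hk, hbal⟩ := Nat.find_spec hex
  have hmin := fun j => Nat.find_min (m := j) hex
  set k := Nat.find hex
  have hf : ((l.take k).map Prod.fst).sum + ((l.drop k).map Prod.fst).sum = n + 1 := by
    rw [← List.sum_append, ← List.map_append, List.take_append_drop, h.2.1]
  have hs : ((l.take k).map Prod.snd).sum + ((l.drop k).map Prod.snd).sum = n + 1 := by
    rw [← List.sum_append, ← List.map_append, List.take_append_drop, h.2.2]
  have hpos : 0 < ((l.take k).map Prod.fst).sum := by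
    obtain ⟨p, t, rfl⟩ := List.exists_cons_of_ne_nil h.ne_nil
    obtain ⟨k', hk'⟩ := Nat.exists_eq_add_of_le' hk
    have := (h.1 p (by simp)).1
    rw [hk', List.take_succ_cons, List.map_cons, List.sum_cons]
    lia
  refine ⟨((l.take k).map Prod.fst).sum - 1, ((l.drop k).map Prod.fst).sum, l.take k, l.drop k,
    by lia, ⟨⟨fun p hp => h.1 p (List.mem_of_mem_take hp), by lia, by lia⟩, fun j hj hjl => ?_⟩,
    ⟨fun p hp => h.1 p (List.mem_of_mem_drop hp), rfl, by lia⟩, List.take_append_drop _ _⟩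
  have hjk : j < k := hjl.trans_le (List.length_take_le _ _)
  rw [List.take_take, min_eq_left hjk.le]
  exact fun hc => hmin j hjk ⟨hj, hc⟩

/-- Concatenation of an irreducible list with an arbitrary list of pairs of parts. -/
def appendIrreducible (n : ℕ)
    (x : Σ q : Finset.HasAntidiagonal.antidiagonal n,
      {l : List (ℕ × ℕ) // IsIrreduciblePairList (q.1.1 + 1) l} ×
      {l : List (ℕ × ℕ) // IsCompositionPairList q.1.2 l}) :
    {l : List (ℕ × ℕ) // IsCompositionPairList (n + 1) l} :=
  ⟨x.2.1.1 ++ x.2.2.1, by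
    have h := x.2.1.2.1.append x.2.2.2
    rwa [add_right_comm, Finset.HasAntidiagonal.mem_antidiagonal.1 x.1.2] at h⟩

theorem appendIrreducible_bijective (n : ℕ) : Function.Bijective (appendIrreducible n) := by
  constructor
  · rintro ⟨⟨⟨i, j⟩, hq⟩, ⟨l₁, h₁⟩, ⟨l₂, h₂⟩⟩ ⟨⟨⟨i', j'⟩, hq'⟩, ⟨l₁', h₁'⟩, ⟨l₂', h₂'⟩⟩ heq
    replace heq : l₁ ++ l₂ = l₁' ++ l₂' := congrArg Subtype.val heq
    obtain ⟨rfl, rfl⟩ := List.append_inj heq <|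
      (h₁'.length_le_of_append_eq h₁ heq.symm).antisymm (h₁.length_le_of_append_eq h₁' heq)
    obtain rfl : i = i' := Nat.succ_injective (h₁.1.2.1.symm.trans h₁'.1.2.1)
    obtain rfl : j = j' := h₂.2.1.symm.trans h₂'.2.1
    rfl
  · rintro ⟨l, hl⟩
    obtain ⟨i, j, l₁, l₂, hij, h₁, h₂, rfl⟩ := hl.exists_append
    exact ⟨⟨⟨(i, j), Finset.HasAntidiagonal.mem_antidiagonal.2 hij⟩, ⟨l₁, h₁⟩, ⟨l₂, h₂⟩⟩, rfl⟩

theorem numCompositionPairs_succ_eq_sum_antidiagonal (n : ℕ) :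
    numCompositionPairs (n + 1) =
      ∑ q ∈ Finset.HasAntidiagonal.antidiagonal n,
        numIrreduciblePairs (q.1 + 1) * numCompositionPairs q.2 := by
  rw [numCompositionPairs, ← Nat.card_congr (Equiv.ofBijective _ (appendIrreducible_bijective n)),
    Nat.card_sigma]
  simp only [Nat.card_prod, numIrreduciblePairs_eq_card_list, numCompositionPairs]
  exact Finset.sum_coe_sort (Finset.HasAntidiagonal.antidiagonal n) fun q =>
    Nat.card {l : List (ℕ × ℕ) // IsIrreduciblePairList (q.1 + 1) l} *
      Nat.card {l : List (ℕ × ℕ) // IsCompositionPairList q.2 l}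

theorem numIrreduciblePairs_succ_le (n : ℕ) : numIrreduciblePairs (n + 1) ≤ n.centralBinom := by
  rw [← numCompositionPairs_succ, numCompositionPairs_succ_eq_sum_antidiagonal]
  have h := Finset.single_le_sum
    (f := fun q : ℕ × ℕ => numIrreduciblePairs (q.1 + 1) * numCompositionPairs q.2)
    (a := (n, 0)) (fun _ _ => Nat.zero_le _)
    (Finset.HasAntidiagonal.mem_antidiagonal.2 (add_zero n))
  simpa [numCompositionPairs_zero] using h

/-- **Generating function for irreducible pairs of compositions**:
for `|z| < 1/4`, `∑_{n≥1} f(n) zⁿ = z / (√(1-4z) + z)` (principal branch),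
the series converging absolutely. -/
theorem irreduciblePairs_gf (z : ℂ) (hz : ‖z‖ < 1 / 4) :
    (Summable fun n : ℕ => ‖(numIrreduciblePairs (n + 1) : ℂ) * z ^ (n + 1)‖) ∧
    ∑' n : ℕ, (numIrreduciblePairs (n + 1) : ℂ) * z ^ (n + 1) =
      z / ((1 - 4 * z) ^ ((1 : ℂ) / 2) + z) := by
  have hS := hasSum_centralBinom_mul_pow hz
  have hA : Summable fun n : ℕ => ‖(numIrreduciblePairs (n + 1) : ℂ) * z ^ n‖ := by
    refine hS.summable.norm.of_nonneg_of_le (fun _ => norm_nonneg _) fun n => ?_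
    simp only [norm_mul, Complex.norm_natCast]
    gcongr
    exact numIrreduciblePairs_succ_le n
  have hC : HasSum (fun n : ℕ => (numCompositionPairs n : ℂ) * z ^ n)
      (1 + z * (1 - 4 * z) ^ (-(1 / 2) : ℂ)) := by
    rw [add_comm, ← hasSum_nat_add_iff' 1]
    simp only [Finset.sum_range_one, numCompositionPairs_zero, Nat.cast_one, pow_zero, mul_one,
      add_sub_cancel_right, numCompositionPairs_succ]
    refine (hS.mul_left z).congr_fun ?_
    intro n
    ring
  have hcauchy := tsum_mul_tsum_eq_tsum_sum_antidiagonal_of_summable_norm hA hC.summable.norm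
  have hconv (n : ℕ) : ∑ q ∈ Finset.HasAntidiagonal.antidiagonal n,
      (numIrreduciblePairs (q.1 + 1) : ℂ) * z ^ q.1 *
      ((numCompositionPairs q.2 : ℂ) * z ^ q.2) = (n.centralBinom : ℂ) * z ^ n := by
    rw [← numCompositionPairs_succ, numCompositionPairs_succ_eq_sum_antidiagonal, Nat.cast_sum,
      Finset.sum_mul]
    refine Finset.sum_congr rfl fun q hq => ?_
    rw [← Finset.HasAntidiagonal.mem_antidiagonal.1 hq, pow_add]
    push_cast
    ring
  simp only [hconv, hC.tsum_eq, hS.tsum_eq] at hcauchy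
  have hw : (1 - 4 * z) ^ ((1 : ℂ) / 2) ≠ 0 := by
    rw [Complex.cpow_ne_zero_iff]
    left
    intro h0
    have : z = 1 / 4 := by linear_combination -h0 / 4
    rw [this] at hz
    norm_num at hz
  rw [Complex.cpow_neg] at hcauchy
  set w := (1 - 4 * z) ^ ((1 : ℂ) / 2)
  field_simp at hcauchy
  have hwz : w + z ≠ 0 := right_ne_zero_of_mul (hcauchy.symm ▸ one_ne_zero)
  have hpow : (fun n : ℕ => (numIrreduciblePairs (n + 1) : ℂ) * z ^ (n + 1)) =
      fun n => z * ((numIrreduciblePairs (n + 1) : ℂ) * z ^ n) := by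
    ext n
    ring
  constructor
  · simpa only [← hpow, norm_mul, pow_succ, mul_assoc] using hA.mul_right ‖z‖
  · rw [hpow, tsum_mul_left, eq_div_iff hwz]
    linear_combination z * hcauchy
end

section
/- The number f(n) of irreducible ordered pairs of compositions of n into the same number of parts satisfies the asymptotic f(n) ∼ (2/√π) · n^{−3/2} · 4^n as n → ∞; that is, f(n) · n^{3/2} · 4^{−n} → 2/√π. -/
open Finset in
theorem card_isComposition_succ (n j : ℕ) (hj : j ≤ n) :
    Nat.card {b : Fin (j + 1) → ℕ // IsComposition (n + 1) (j + 1) b} = n.choose j := by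
  have e : {b : Fin (j + 1) → ℕ // IsComposition (n + 1) (j + 1) b} ≃
      (Finset.univ : Finset (Fin (j + 1))).finsuppAntidiag (n - j) :=
    { toFun := fun b => ⟨Finsupp.equivFunOnFinite.symm fun i => b.1 i - 1, by
        obtain ⟨b, hb, hs⟩ := b
        have h : ∑ i, (b i - 1 + 1) = n + 1 := by
          rw [← hs]
          exact Finset.sum_congr rfl fun i _ => Nat.sub_add_cancel (hb i)
        rw [Finset.sum_add_distrib] at h
        simp only [sum_const, card_univ, Fintype.card_fin, smul_eq_mul, mul_one] at h
        simp only [mem_finsuppAntidiag, Finsupp.equivFunOnFinite_symm_apply_apply, subset_univ,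
          and_true]
        omega⟩
      invFun := fun c => ⟨fun i => c.1 i + 1, fun i => Nat.succ_pos _, by
        have h := (mem_finsuppAntidiag.1 c.2).1
        rw [Finset.sum_add_distrib, h]
        simp
        omega⟩
      left_inv := fun b => Subtype.ext (funext fun i => Nat.sub_add_cancel (b.2.1 i))
      right_inv := fun c => Subtype.ext (Finsupp.ext fun i => by simp) }
  rw [Nat.card_congr e, Nat.card_eq_fintype_card, Fintype.card_coe,
    card_finsuppAntidiag_nat_eq_choose, card_univ, Fintype.card_fin,
    show j + 1 + (n - j) - 1 = n by omega, Nat.choose_symm hj]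

/-- Pairs of compositions of `n` with equally many parts, as lists of pairs of parts. -/
def compositionPairs (n : ℕ) : Set (List (ℕ × ℕ)) :=
  {l | (∀ p ∈ l, 0 < p.1 ∧ 0 < p.2) ∧ l.sum = (n, n)}

/-- The irreducible members of `compositionPairs n`. -/
def irreducibleCompositionPairs (n : ℕ) : Set (List (ℕ × ℕ)) :=
  {l | l ∈ compositionPairs n ∧
    ∀ j, 1 ≤ j → j < l.length → (l.take j).sum.1 ≠ (l.take j).sum.2}

/-- Pairs of tuples of the same length correspond to lists of pairs. -/
def tuplePairEquivList : (Σ k : ℕ, (Fin k → ℕ) × (Fin k → ℕ)) ≃ List (ℕ × ℕ) :=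
  (Equiv.sigmaCongrRight fun k =>
    (Equiv.arrowProdEquivProdArrow (Fin k) (fun _ => ℕ) (fun _ => ℕ)).symm).trans
      List.equivSigmaTuple.symm

theorem tuplePairEquivList_apply (p : Σ k : ℕ, (Fin k → ℕ) × (Fin k → ℕ)) :
    tuplePairEquivList p = List.ofFn fun i => (p.2.1 i, p.2.2 i) := rfl

theorem tuplePairEquivList_mem_compositionPairs (n : ℕ)
    (p : Σ k : ℕ, (Fin k → ℕ) × (Fin k → ℕ)) :
    tuplePairEquivList p ∈ compositionPairs n ↔
      IsComposition n p.1 p.2.1 ∧ IsComposition n p.1 p.2.2 := by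
  simp only [tuplePairEquivList_apply, compositionPairs, Set.mem_ofPred_eq, List.forall_mem_ofFn_iff,
    List.sum_ofFn, IsComposition, Prod.ext_iff, Prod.fst_sum, Prod.snd_sum, forall_and]
  tauto

theorem tuplePairEquivList_mem_irreducibleCompositionPairs (n : ℕ)
    (p : Σ k : ℕ, (Fin k → ℕ) × (Fin k → ℕ)) :
    IsIrreduciblePair n p.1 p.2.1 p.2.2 ↔
      tuplePairEquivList p ∈ irreducibleCompositionPairs n := by
  rw [irreducibleCompositionPairs, Set.mem_ofPred_eq, tuplePairEquivList_mem_compositionPairs,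
    and_assoc]
  simp only [tuplePairEquivList_apply, IsIrreduciblePair, List.length_ofFn, List.sum_take_ofFn,
    Prod.fst_sum, Prod.snd_sum]

theorem numIrreduciblePairs_eq_card (n : ℕ) :
    numIrreduciblePairs n = Nat.card (irreducibleCompositionPairs n) :=
  Nat.card_congr (tuplePairEquivList.subtypeEquiv
    (tuplePairEquivList_mem_irreducibleCompositionPairs n))

theorem length_le_sum_fst {l : List (ℕ × ℕ)} (h : ∀ p ∈ l, 0 < p.1 ∧ 0 < p.2) :
    l.length ≤ l.sum.1 := by
  induction l with
  | nil => simp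
  | cons a l ih =>
    have h1 := ih fun p hp => h p (List.mem_cons_of_mem _ hp)
    have h2 := (h a List.mem_cons_self).1
    simp only [List.length_cons, List.sum_cons, Prod.fst_add]
    omega

theorem card_compositionPairs_succ (n : ℕ) :
    Nat.card (compositionPairs (n + 1)) = n.centralBinom := by
  let C (j : ℕ) := {b : Fin (j + 1) → ℕ // IsComposition (n + 1) (j + 1) b}
  let φ : (Σ j : Fin (n + 1), C j × C j) → compositionPairs (n + 1) := fun p =>
    ⟨tuplePairEquivList ⟨p.1 + 1, p.2.1.1, p.2.2.1⟩,
      (tuplePairEquivList_mem_compositionPairs _ _).2 ⟨p.2.1.2, p.2.2.2⟩⟩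
  have hφ : Function.Bijective φ := by
    constructor
    · rintro ⟨⟨j, hj⟩, ⟨b, hb⟩, ⟨c, hc⟩⟩ ⟨⟨j', hj'⟩, ⟨b', hb'⟩, ⟨c', hc'⟩⟩ h
      have h := tuplePairEquivList.injective (congrArg Subtype.val h)
      simp only [Sigma.mk.injEq, Nat.add_right_cancel_iff] at h
      obtain ⟨rfl, h⟩ := h
      simp only [heq_eq_eq, Prod.mk.injEq] at h
      obtain ⟨rfl, rfl⟩ := h
      rfl
    · rintro ⟨l, hl⟩
      obtain ⟨⟨k, b, c⟩, rfl⟩ := tuplePairEquivList.surjective l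
      have hk := length_le_sum_fst hl.1
      have hs := hl.2
      rw [hs] at hk
      simp only [tuplePairEquivList_apply, List.length_ofFn] at hk
      obtain ⟨hb, hc⟩ := (tuplePairEquivList_mem_compositionPairs _ _).1 hl
      cases k with
      | zero => simpa using hb.2
      | succ j => exact ⟨⟨⟨j, by omega⟩, ⟨b, hb⟩, ⟨c, hc⟩⟩, rfl⟩
  have hC (j : Fin (n + 1)) : Nat.card (C j) = n.choose j :=
    card_isComposition_succ n j (Nat.lt_succ_iff.1 j.2)
  have hfin (j : Fin (n + 1)) : Finite (C j) :=
    Nat.finite_of_card_ne_zero (by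
      rw [hC]
      exact (Nat.choose_pos (Nat.lt_succ_iff.1 j.2)).ne')
  rw [← Nat.card_congr (Equiv.ofBijective φ hφ), Nat.card_sigma]
  simp only [Nat.card_prod, hC, ← sq]
  rw [Fin.sum_univ_eq_sum_range (fun j => n.choose j ^ 2), Nat.sum_range_choose_sq, Nat.centralBinom]

theorem compositionPairs_zero : compositionPairs 0 = {[]} := by
  ext l
  constructor
  · rintro ⟨h, hs⟩
    have := length_le_sum_fst h
    rw [hs] at this
    simpa using this
  · rintro rfl
    exact ⟨by simp, rfl⟩

instance finite_compositionPairs (n : ℕ) : Finite (compositionPairs n) := by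
  cases n with
  | zero => rw [compositionPairs_zero]; infer_instance
  | succ n =>
    exact Nat.finite_of_card_ne_zero (by
      rw [card_compositionPairs_succ]
      exact n.centralBinom_ne_zero)

instance finite_irreducibleCompositionPairs (n : ℕ) : Finite (irreducibleCompositionPairs n) :=
  (Set.toFinite (compositionPairs n)).subset fun _ h => h.1

theorem eq_of_append_eq_append {m m' : ℕ} {l₁ l₂ l₁' l₂' : List (ℕ × ℕ)}
    (h₁ : l₁ ∈ compositionPairs (m + 1)) (h₁' : l₁' ∈ irreducibleCompositionPairs (m' + 1))
    (hle : l₁.length ≤ l₁'.length) (h : l₁ ++ l₂ = l₁' ++ l₂') : l₁ = l₁' := by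
  have ht : l₁'.take l₁.length = l₁ := by
    have := congrArg (List.take l₁.length) h
    rwa [List.take_left, List.take_append_of_le_length hle, eq_comm] at this
  have hpos : 1 ≤ l₁.length := by
    rw [Nat.one_le_iff_ne_zero, Ne, List.length_eq_zero_iff]
    rintro rfl
    simpa using congrArg Prod.fst h₁.2
  rcases hle.lt_or_eq with hlt | heq
  · refine absurd ?_ (h₁'.2 _ hpos hlt)
    rw [ht, h₁.2]
  · rwa [heq, List.take_length, eq_comm] at ht

theorem card_compositionPairs_succ_eq_sum (n : ℕ) :
    Nat.card (compositionPairs (n + 1)) = ∑ p ∈ Finset.HasAntidiagonal.antidiagonal n,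
      Nat.card (irreducibleCompositionPairs (p.1 + 1)) * Nat.card (compositionPairs p.2) := by
  let φ : (Σ p : Finset.HasAntidiagonal.antidiagonal n,
      irreducibleCompositionPairs (p.1.1 + 1) × compositionPairs p.1.2) →
        compositionPairs (n + 1) := fun x =>
    ⟨x.2.1.1 ++ x.2.2.1, by
      obtain ⟨⟨p, hp⟩, ⟨l₁, h₁⟩, ⟨l₂, h₂⟩⟩ := x
      rw [Finset.HasAntidiagonal.mem_antidiagonal] at hp
      constructor
      · intro q hq
        rcases List.mem_append.1 hq with hq | hq
        exacts [h₁.1.1 q hq, h₂.1 q hq]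
      · simp only [List.sum_append, h₁.1.2, h₂.2, Prod.mk_add_mk, Prod.mk.injEq, and_self]
        omega⟩
  have hφ : Function.Bijective φ := by
    constructor
    · rintro ⟨⟨⟨p, q⟩, hp⟩, ⟨l₁, h₁⟩, ⟨l₂, h₂⟩⟩ ⟨⟨⟨p', q'⟩, hp'⟩, ⟨l₁', h₁'⟩, ⟨l₂', h₂'⟩⟩ h
      replace h : l₁ ++ l₂ = l₁' ++ l₂' := congrArg Subtype.val h
      have h1 : l₁ = l₁' := by
        rcases le_total l₁.length l₁'.length with hle | hle
        · exact eq_of_append_eq_append h₁.1 h₁' hle h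
        · exact (eq_of_append_eq_append h₁'.1 h₁ hle h.symm).symm
      subst h1
      obtain rfl := List.append_cancel_left h
      have e1 := congrArg Prod.fst (h₁.1.2.symm.trans h₁'.1.2)
      have e2 := congrArg Prod.fst (h₂.2.symm.trans h₂'.2)
      simp only [Nat.add_right_cancel_iff] at e1 e2
      subst e1 e2
      rfl
    · rintro ⟨l, hl⟩
      have hex : ∃ j, 1 ≤ j ∧ (l.take j).sum.1 = (l.take j).sum.2 := by
        refine ⟨l.length + 1, by omega, ?_⟩
        rw [List.take_of_length_le (by omega), hl.2]
      classical
      obtain ⟨hj1, hj2⟩ := Nat.find_spec hex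
      have hmin : ∀ i < Nat.find hex, 1 ≤ i → (l.take i).sum.1 ≠ (l.take i).sum.2 :=
        fun i hi h1 h2 => Nat.find_min hex hi ⟨h1, h2⟩
      generalize Nat.find hex = j at hj1 hj2 hmin
      have hsplit := List.take_append_drop j l
      have hsum : (l.take j).sum + (l.drop j).sum = (n + 1, n + 1) := by
        rw [← List.sum_append, hsplit, hl.2]
      have hpos : 1 ≤ (l.take j).sum.1 := by
        refine le_trans ?_ (length_le_sum_fst fun p hp => hl.1 p (List.mem_of_mem_take hp))
        rw [List.length_take, Nat.one_le_iff_ne_zero]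
        intro h0
        have : l = [] := by
          rw [← List.length_eq_zero_iff]
          omega
        simpa [this] using congrArg Prod.fst hl.2
      rw [Prod.ext_iff] at hsum
      simp only [Prod.fst_add, Prod.snd_add] at hsum
      refine ⟨⟨⟨((l.take j).sum.1 - 1, (l.drop j).sum.1), ?_⟩, ⟨l.take j, ⟨⟨?_, ?_⟩, ?_⟩⟩,
        ⟨l.drop j, ⟨?_, ?_⟩⟩⟩, Subtype.ext hsplit⟩
      · rw [Finset.HasAntidiagonal.mem_antidiagonal]
        dsimp only
        omega
      · exact fun p hp => hl.1 p (List.mem_of_mem_take hp)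
      · exact Prod.ext (by dsimp only; omega) (by dsimp only; omega)
      · intro i hi hil
        rw [List.length_take] at hil
        rw [List.take_take, min_eq_left (by omega)]
        exact hmin i (by omega) hi
      · exact fun p hp => hl.1 p (List.mem_of_mem_drop hp)
      · exact Prod.ext rfl (by dsimp only; omega)
  rw [← Nat.card_congr (Equiv.ofBijective φ hφ), Nat.card_sigma]
  simp only [Nat.card_prod]
  exact Finset.sum_coe_sort (Finset.HasAntidiagonal.antidiagonal n) fun p =>
    Nat.card (irreducibleCompositionPairs (p.1 + 1)) * Nat.card (compositionPairs p.2)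

theorem numIrreduciblePairs_succ_le_four_pow (n : ℕ) : numIrreduciblePairs (n + 1) ≤ 4 ^ n := by
  rw [numIrreduciblePairs_eq_card]
  refine le_trans ?_ n.centralBinom_le_four_pow
  rw [← card_compositionPairs_succ]
  exact Nat.card_mono (Set.toFinite _) fun _ h => h.1

open PowerSeries in
/-- The power series `√(1 - 4X)`, expressed through Catalan numbers. -/
noncomputable def sqrtOneSubFourX : PowerSeries ℝ :=
  1 - 2 * X * PowerSeries.mk fun n => (catalan n : ℝ)

open PowerSeries in
theorem sqrtOneSubFourX_sq : sqrtOneSubFourX ^ 2 = 1 - 4 * X := by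
  have h : (PowerSeries.mk fun n => (catalan n : ℝ)) =
      PowerSeries.map (Nat.castRingHom ℝ) catalanSeries := by
    ext n
    simp
  have hC := congrArg (PowerSeries.map (Nat.castRingHom ℝ)) catalanSeries_sq_mul_X_add_one
  simp only [map_add, map_mul, map_pow, map_one, map_X, ← h] at hC
  rw [sqrtOneSubFourX]
  linear_combination (4 * X : PowerSeries ℝ) * hC

open PowerSeries in
theorem mk_centralBinom_mul_sqrtOneSubFourX :
    (PowerSeries.mk fun n => (n.centralBinom : ℝ)) * sqrtOneSubFourX = 1 := by
  have hd : derivative ℝ sqrtOneSubFourX =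
      -2 * PowerSeries.mk fun n => (n.centralBinom : ℝ) := by
    have h2 : (2 : PowerSeries ℝ) = C (2 : ℝ) := (map_ofNat C 2).symm
    ext n
    rw [sqrtOneSubFourX, coeff_derivative, neg_mul, mul_assoc, h2, map_sub, map_neg, coeff_C_mul,
      coeff_C_mul, coeff_succ_X_mul, coeff_mk, coeff_mk, coeff_one, if_neg n.succ_ne_zero,
      ← succ_mul_catalan_eq_centralBinom]
    push_cast
    ring
  have h := congrArg (derivative ℝ) sqrtOneSubFourX_sq
  have h4 : derivative ℝ (4 : PowerSeries ℝ) = 0 := by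
    rw [show (4 : PowerSeries ℝ) = C (4 : ℝ) from (map_ofNat C 4).symm, derivative_C]
  rw [sq, Derivation.leibniz, hd, map_sub, Derivation.leibniz, h4, derivative_X] at h
  simp only [smul_eq_mul, mul_zero, mul_one, add_zero] at h
  have h4' : (4 : PowerSeries ℝ) ≠ 0 := by
    rw [show (4 : PowerSeries ℝ) = C (4 : ℝ) from (map_ofNat C 4).symm]
    simp
  refine mul_left_cancel₀ h4' ?_
  rw [Derivation.map_one_eq_zero] at h
  linear_combination -h

open PowerSeries in
theorem mk_numIrreduciblePairs_mul :
    (PowerSeries.mk fun n => (numIrreduciblePairs (n + 1) : ℝ)) * (1 - 4 * X - X ^ 2) =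
      sqrtOneSubFourX - X := by
  set B : PowerSeries ℝ := PowerSeries.mk fun n => (n.centralBinom : ℝ)
  set G : PowerSeries ℝ := PowerSeries.mk fun n => (numIrreduciblePairs (n + 1) : ℝ) with hG
  let W : PowerSeries ℝ := PowerSeries.mk fun n => (Nat.card (compositionPairs n) : ℝ)
  have hW : W = 1 + X * B := by
    ext n
    cases n with
    | zero => simp [W, compositionPairs_zero]
    | succ n =>
      rw [map_add, coeff_succ_X_mul, coeff_one, if_neg n.succ_ne_zero, coeff_mk, coeff_mk,
        card_compositionPairs_succ, zero_add]
  have hWG : W = 1 + X * (G * W) := by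
    ext n
    cases n with
    | zero => simp [W, compositionPairs_zero]
    | succ n =>
      rw [map_add, coeff_succ_X_mul, coeff_one, if_neg n.succ_ne_zero, coeff_mk, coeff_mul,
        card_compositionPairs_succ_eq_sum, zero_add]
      simp [hG, W, numIrreduciblePairs_eq_card]
  rw [hW] at hWG
  have hs := sqrtOneSubFourX_sq
  have hBs : B * sqrtOneSubFourX = 1 := mk_centralBinom_mul_sqrtOneSubFourX
  set s := sqrtOneSubFourX
  refine mul_left_cancel₀ (X_ne_zero (R := ℝ)) ?_
  have h1 : s + X = s + X * G * (s + X) := by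
    linear_combination s * hWG + (X ^ 2 * G - X) * hBs
  linear_combination -(X * G) * hs - (s - X) * h1

theorem numIrreduciblePairs_recurrence (n : ℕ) :
    (numIrreduciblePairs (n + 3) : ℝ) =
      4 * numIrreduciblePairs (n + 2) + numIrreduciblePairs (n + 1) - 2 * catalan (n + 1) := by
  have h := congrArg (PowerSeries.coeff (n + 2)) mk_numIrreduciblePairs_mul
  have h2 : (2 : PowerSeries ℝ) = PowerSeries.C (2 : ℝ) := (map_ofNat PowerSeries.C 2).symm
  have h4 : (4 : PowerSeries ℝ) = PowerSeries.C (4 : ℝ) := (map_ofNat PowerSeries.C 4).symm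
  rw [mul_sub, mul_sub, mul_one, h4, mul_left_comm, sqrtOneSubFourX, h2, mul_assoc] at h
  simp only [map_sub, PowerSeries.coeff_C_mul, PowerSeries.coeff_mul_X_pow, PowerSeries.coeff_mk,
    PowerSeries.coeff_succ_mul_X, PowerSeries.coeff_succ_X_mul, PowerSeries.coeff_one,
    PowerSeries.coeff_X] at h
  rw [if_neg (by omega), if_neg (by omega)] at h
  linarith

open Filter Topology

/-- If `ωₙ / ωₙ₊₁ → 1`, then `ωₙ / ωₙ₊ₖ → 1` for every `k`. -/
theorem tendsto_div_shift {ω : ℕ → ℝ} (hpos : ∀ n, 0 < ω n)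
    (hω : Tendsto (fun n => ω n / ω (n + 1)) atTop (𝓝 1)) (k : ℕ) :
    Tendsto (fun n => ω n / ω (n + k)) atTop (𝓝 1) := by
  induction k with
  | zero => simp [div_self (hpos _).ne']
  | succ k ih =>
    have h := ih.mul (hω.comp (tendsto_add_atTop_nat k))
    rw [mul_one] at h
    refine h.congr fun n => ?_
    have := (hpos (n + k)).ne'
    have := (hpos (n + k + 1)).ne'
    simp only [Function.comp_apply, ← add_assoc]
    field_simp

/-- A bounded solution of a backward contracting recurrence decays like its forcing term. -/
theorem tendsto_mul_of_backward_recurrence {ω H e : ℕ → ℝ} {r D M : ℝ} (hpos : ∀ n, 0 < ω n)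
    (hmono : Monotone ω) (hω : Tendsto (fun n => ω n / ω (n + 1)) atTop (𝓝 1))
    (hr0 : 0 ≤ r) (hr1 : r < 1) (hM : ∀ n, |H n| ≤ M) (hrec : ∀ n, H n = r * H (n + 1) + e n)
    (he : Tendsto (fun n => ω n * e n) atTop (𝓝 D)) :
    Tendsto (fun n => ω n * H n) atTop (𝓝 (D / (1 - r))) := by
  obtain ⟨K, hK⟩ := he.abs.bddAbove_range
  have hK' (n : ℕ) : |ω n * e n| ≤ K := hK ⟨n, rfl⟩
  have hbound (n k : ℕ) : ‖r ^ k * (ω n * e (n + k))‖ ≤ K * r ^ k := by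
    rw [norm_mul, norm_pow, Real.norm_of_nonneg hr0, mul_comm]
    refine mul_le_mul_of_nonneg_right (le_trans ?_ (hK' (n + k))) (pow_nonneg hr0 k)
    rw [Real.norm_eq_abs, abs_mul, abs_mul, abs_of_pos (hpos n), abs_of_pos (hpos _)]
    exact mul_le_mul_of_nonneg_right (hmono (Nat.le_add_right n k)) (abs_nonneg _)
  have hgeom : Summable fun k : ℕ => K * r ^ k :=
    (summable_geometric_of_lt_one hr0 hr1).mul_left K
  have hpartial (n N : ℕ) :
      ∑ k ∈ Finset.range N, r ^ k * (ω n * e (n + k)) = ω n * H n - ω n * (r ^ N * H (n + N)) := by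
    induction N with
    | zero => simp
    | succ N ih =>
      rw [Finset.sum_range_succ, ih, hrec (n + N), ← add_assoc]
      ring
  have hsum (n : ℕ) : ∑' k, r ^ k * (ω n * e (n + k)) = ω n * H n := by
    have hs : Summable fun k => r ^ k * (ω n * e (n + k)) :=
      Summable.of_norm_bounded hgeom (hbound n)
    refine tendsto_nhds_unique hs.hasSum.tendsto_sum_nat ?_
    simp only [hpartial]
    have hz : Tendsto (fun N => r ^ N * H (n + N)) atTop (𝓝 0) := by
      refine squeeze_zero_norm (a := fun N => r ^ N * M) (fun N => ?_) ?_
      · rw [norm_mul, norm_pow, Real.norm_of_nonneg hr0]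
        exact mul_le_mul_of_nonneg_left (hM _) (pow_nonneg hr0 N)
      · simpa using (tendsto_pow_atTop_nhds_zero_of_lt_one hr0 hr1).mul_const M
    simpa using (hz.const_mul (ω n)).const_sub (ω n * H n)
  have hlim : ∑' k : ℕ, r ^ k * D = D / (1 - r) := by
    rw [tsum_mul_right, tsum_geometric_of_lt_one hr0 hr1, mul_comm, div_eq_mul_inv]
  rw [← hlim]
  simp only [← hsum]
  refine tendsto_tsum_of_dominated_convergence hgeom (fun k => ?_)
    (Eventually.of_forall fun n k => hbound n k)
  refine Tendsto.const_mul _ ?_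
  have h := (tendsto_div_shift hpos hω k).mul (he.comp (tendsto_add_atTop_nat k))
  rw [one_mul] at h
  refine h.congr fun n => ?_
  have := (hpos (n + k)).ne'
  simp only [Function.comp_apply]
  field_simp

/-- A perturbation of a contracting linear recurrence with vanishing forcing tends to zero. -/
theorem tendsto_zero_of_abs_le_mul_add {x ε : ℕ → ℝ} {ρ : ℝ} (h0 : 0 ≤ ρ) (h1 : ρ < 1)
    (hx : ∀ᶠ n in atTop, |x (n + 1)| ≤ ρ * |x n| + ε n) (hε : Tendsto ε atTop (𝓝 0)) :
    Tendsto x atTop (𝓝 0) := by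
  rw [Metric.tendsto_atTop]
  intro δ hδ
  have hη : 0 < δ * (1 - ρ) / 2 := by
    have := sub_pos.2 h1
    positivity
  obtain ⟨N, hN⟩ := eventually_atTop.1 (hx.and (hε.eventually (gt_mem_nhds hη)))
  have hbound (k : ℕ) : |x (N + k)| ≤ ρ ^ k * |x N| + δ / 2 := by
    induction k with
    | zero => simpa using (half_pos hδ).le
    | succ k ih =>
      obtain ⟨h2, h3⟩ := hN (N + k) (Nat.le_add_right N k)
      have h4 := mul_le_mul_of_nonneg_left ih h0
      rw [← add_assoc, pow_succ]
      nlinarith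
  have hz : Tendsto (fun k => ρ ^ k * |x N|) atTop (𝓝 0) := by
    simpa using (tendsto_pow_atTop_nhds_zero_of_lt_one h0 h1).mul_const |x N|
  obtain ⟨K, hK⟩ := eventually_atTop.1 (hz.eventually (gt_mem_nhds (half_pos hδ)))
  refine ⟨N + K, fun n hn => ?_⟩
  have h5 := hbound (n - N)
  have h6 := hK (n - N) (by omega)
  rw [Nat.add_sub_cancel' (by omega)] at h5
  rw [dist_zero_right, Real.norm_eq_abs]
  linarith

/-- A solution of a forward contracting recurrence decays like its forcing term, provided the
weight grows slowly. -/
theorem tendsto_mul_of_forward_recurrence {ω G H : ℕ → ℝ} {q L : ℝ} (hpos : ∀ n, 0 < ω n)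
    (hω : Tendsto (fun n => ω n / ω (n + 1)) atTop (𝓝 1)) (hq0 : 0 ≤ q) (hq1 : q < 1)
    (hrec : ∀ n, G (n + 1) = -q * G n + H n)
    (hH : Tendsto (fun n => ω n * H n) atTop (𝓝 L)) :
    Tendsto (fun n => ω n * G n) atTop (𝓝 (L / (1 + q))) := by
  set L' := L / (1 + q) with hL'
  have hL : L - q * L' - L' = 0 := by
    rw [hL']
    field_simp
    ring
  have ha : Tendsto (fun n => ω (n + 1) / ω n) atTop (𝓝 1) := by
    simpa using hω.inv₀ one_ne_zero
  have hqa : ∀ᶠ n in atTop, q * (ω (n + 1) / ω n) < (q + 1) / 2 := by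
    have h := ha.const_mul q
    rw [mul_one] at h
    exact h.eventually (gt_mem_nhds (by linarith))
  have hε : Tendsto (fun n => ω (n + 1) / ω n * (ω n * H n) - q * (ω (n + 1) / ω n) * L' - L')
      atTop (𝓝 0) := by
    have h := ((ha.mul hH).sub ((ha.const_mul q).mul_const L')).sub_const L'
    rwa [one_mul, mul_one, hL] at h
  have hx : Tendsto (fun n => ω n * G n - L') atTop (𝓝 0) := by
    refine tendsto_zero_of_abs_le_mul_add (ρ := (q + 1) / 2) (by linarith) (by linarith) ?_
      (by simpa using hε.abs)
    filter_upwards [hqa] with n hn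
    have hne := (hpos n).ne'
    have key : ω (n + 1) * G (n + 1) - L' = -(q * (ω (n + 1) / ω n)) * (ω n * G n - L') +
        (ω (n + 1) / ω n * (ω n * H n) - q * (ω (n + 1) / ω n) * L' - L') := by
      rw [hrec]
      field_simp
      ring
    rw [key]
    refine (abs_add_le _ _).trans (add_le_add_left ?_ _)
    rw [abs_mul, abs_neg, abs_of_nonneg (mul_nonneg hq0 (div_pos (hpos _) (hpos n)).le)]
    exact mul_le_mul_of_nonneg_right hn.le (abs_nonneg _)
  simpa using hx.add_const L'

theorem tendsto_centralBinom_mul_sqrt_div :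
    Tendsto (fun n : ℕ => (n.centralBinom : ℝ) * √n / 4 ^ n) atTop (𝓝 (1 / √Real.pi)) := by
  have hpi : √Real.pi ≠ 0 := (Real.sqrt_pos.2 Real.pi_pos).ne'
  have h := (Stirling.tendsto_stirlingSeq_sqrt_pi.comp
    (tendsto_id.const_mul_atTop' (two_pos : 0 < 2))).div
      (Stirling.tendsto_stirlingSeq_sqrt_pi.pow 2) (pow_ne_zero 2 hpi)
  have hlim : √Real.pi / √Real.pi ^ 2 = 1 / √Real.pi := by
    field_simp
  rw [hlim] at h
  refine h.congr' ?_
  filter_upwards [eventually_ge_atTop 1] with n hn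
  have hn0 : (0 : ℝ) < n := by exact_mod_cast hn
  have hc : ((2 * n).factorial : ℝ) = n.centralBinom * n.factorial ^ 2 := by
    have := Nat.choose_mul_factorial_mul_factorial (show n ≤ 2 * n by omega)
    rw [← Nat.centralBinom_eq_two_mul_choose, show 2 * n - n = n by omega] at this
    rw [← this]
    push_cast
    ring
  have hs : √(2 * (2 * n : ℝ)) = 2 * √n := by
    rw [← mul_assoc, Real.sqrt_mul (by norm_num), show (2 * 2 : ℝ) = 2 ^ 2 by norm_num,
      Real.sqrt_sq (by norm_num)]
  have hs2 : √(2 * n : ℝ) ^ 2 = 2 * n := Real.sq_sqrt (by positivity)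
  have hs3 : √(n : ℝ) * √n = n := Real.mul_self_sqrt hn0.le
  have hfac : (n.factorial : ℝ) ≠ 0 := by exact_mod_cast n.factorial_ne_zero
  have hsn : √(n : ℝ) ≠ 0 := (Real.sqrt_pos.2 hn0).ne'
  have hpow : (2 * n / Real.exp 1 : ℝ) ^ (2 * n) = 4 ^ n * ((n / Real.exp 1) ^ n) ^ 2 := by
    rw [mul_div_assoc, mul_pow, pow_mul (2 : ℝ), pow_mul' (n / Real.exp 1 : ℝ)]
    norm_num
  have he : ((n : ℝ) / Real.exp 1) ^ n ≠ 0 := by positivity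
  simp only [Function.comp_apply, Pi.div_apply, Stirling.stirlingSeq, id]
  push_cast
  rw [hs, hpow, hc]
  generalize ((n : ℝ) / Real.exp 1) ^ n = E at he ⊢
  rw [div_pow, mul_pow, hs2]
  field_simp
  linear_combination (-(n.centralBinom : ℝ)) * hs3

/-- The polynomial weight `(n + 1) ^ (3 / 2)`. -/
noncomputable def weight (n : ℕ) : ℝ := ((n : ℝ) + 1) ^ (3 / 2 : ℝ)

theorem weight_pos (n : ℕ) : 0 < weight n := Real.rpow_pos_of_pos (by positivity) _

theorem weight_mono : Monotone weight := fun m n h =>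
  Real.rpow_le_rpow (by positivity) (by gcongr) (by norm_num)

theorem tendsto_weight_div_succ : Tendsto (fun n => weight n / weight (n + 1)) atTop (𝓝 1) := by
  have h := ((tendsto_natCast_div_add_atTop (1 : ℝ)).comp (tendsto_add_atTop_nat 1)).rpow_const
    (p := (3 / 2 : ℝ)) (Or.inl one_ne_zero)
  rw [Real.one_rpow] at h
  refine h.congr fun n => ?_
  simp only [Function.comp_apply, weight]
  push_cast
  exact Real.div_rpow (by positivity) (by positivity) _

theorem tendsto_weight_mul_catalan :
    Tendsto (fun n => weight n * (catalan n / 4 ^ n)) atTop (𝓝 (1 / √Real.pi)) := by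
  have h1 : Tendsto (fun n : ℕ => √((n : ℝ) / (n + 1))) atTop (𝓝 1) := by
    simpa using (tendsto_natCast_div_add_atTop (1 : ℝ)).sqrt
  have h := tendsto_centralBinom_mul_sqrt_div.div h1 one_ne_zero
  rw [div_one] at h
  refine h.congr' ?_
  filter_upwards [eventually_ge_atTop 1] with n hn
  have hn0 : (0 : ℝ) < n := by exact_mod_cast hn
  have hw : weight n = (n + 1) * √(n + 1) := by
    rw [weight, show (3 / 2 : ℝ) = 1 + 1 / 2 by norm_num, Real.rpow_add (by positivity),
      Real.rpow_one, ← Real.sqrt_eq_rpow]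
  have hc : (n.centralBinom : ℝ) = (n + 1) * catalan n := by
    rw [← succ_mul_catalan_eq_centralBinom]
    push_cast
    ring
  have hs1 : √(n : ℝ) ≠ 0 := (Real.sqrt_pos.2 hn0).ne'
  have hs2 : √(n + 1 : ℝ) ≠ 0 := (Real.sqrt_pos.2 (by positivity)).ne'
  simp only [Pi.div_apply]
  rw [hw, hc, Real.sqrt_div' _ (by positivity)]
  field_simp

/-- **Asymptotics for irreducible pairs of compositions**:
`f(n) ∼ (2/√π) n^{-3/2} 4ⁿ` as `n → ∞`. -/
theorem irreduciblePairs_asymptotics :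
    Filter.Tendsto
      (fun n : ℕ =>
        (numIrreduciblePairs n : ℝ) * (n : ℝ) ^ (3 / 2 : ℝ) / 4 ^ n)
      Filter.atTop (nhds (2 / Real.sqrt Real.pi)) := by
  let G (n : ℕ) : ℝ := numIrreduciblePairs (n + 1) / 4 ^ n
  have hG0 (n : ℕ) : 0 ≤ G n := by positivity
  have hG1 (n : ℕ) : G n ≤ 1 :=
    div_le_one_of_le₀ (by exact_mod_cast numIrreduciblePairs_succ_le_four_pow n) (by positivity)
  have hGrec (n : ℕ) : G (n + 2) = G (n + 1) + G n / 16 - catalan (n + 1) / 4 ^ (n + 1) / 2 := by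
    simp only [G, numIrreduciblePairs_recurrence]
    field_simp
    ring
  set q : ℝ := (√5 - 2) / 4 with hq
  have h5 : √(5 : ℝ) ^ 2 = 5 := Real.sq_sqrt (by norm_num)
  have hq2 : 16 * q ^ 2 + 16 * q = 1 := by
    rw [hq]
    linear_combination h5
  have hq0 : 0 < q := by
    have : 2 < √(5 : ℝ) := Real.lt_sqrt_of_sq_lt (by norm_num)
    rw [hq]
    linarith
  have hq1 : 16 * q < 1 := by nlinarith
  let H (n : ℕ) : ℝ := G (n + 1) + q * G n
  have hHrec (n : ℕ) : H n = 16 * q * H (n + 1) + 8 * q * (catalan (n + 1) / 4 ^ (n + 1)) := by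
    simp only [H]
    rw [hGrec n]
    linear_combination (-G (n + 1)) * hq2
  have hHbound (n : ℕ) : |H n| ≤ 2 := by
    have := hG0 n
    have := hG0 (n + 1)
    have := hG1 n
    have := hG1 (n + 1)
    rw [abs_of_nonneg (by positivity)]
    simp only [H]
    nlinarith
  have hforce : Tendsto (fun n => weight n * (8 * q * (catalan (n + 1) / 4 ^ (n + 1)))) atTop
      (𝓝 (8 * q * (1 / √Real.pi))) := by
    have h := (tendsto_weight_div_succ.mul
      (tendsto_weight_mul_catalan.comp (tendsto_add_atTop_nat 1))).const_mul (8 * q)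
    rw [one_mul] at h
    refine h.congr fun n => ?_
    have := (weight_pos (n + 1)).ne'
    simp only [Function.comp_apply]
    field_simp
  have hH := tendsto_mul_of_backward_recurrence weight_pos weight_mono tendsto_weight_div_succ
    (by positivity) hq1 hHbound hHrec hforce
  have hG := tendsto_mul_of_forward_recurrence weight_pos tendsto_weight_div_succ hq0.le
    (by linarith) (fun n => show G (n + 1) = -q * G n + H n by simp only [H]; ring) hH
  have hpi : √Real.pi ≠ 0 := (Real.sqrt_pos.2 Real.pi_pos).ne'
  have hlim : 8 * q * (1 / √Real.pi) / (1 - 16 * q) / (1 + q) / 4 = 2 / √Real.pi := by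
    have h1 : 1 - 16 * q = 16 * q ^ 2 := by linarith
    have h2 : 1 + q ≠ 0 := by linarith
    rw [h1]
    clear_value q
    field_simp
    linear_combination -8 * hq2
  have hfin := hG.div_const 4
  rw [hlim] at hfin
  refine (tendsto_add_atTop_iff_nat 1).1 (hfin.congr fun n => ?_)
  simp only [G, weight, pow_succ]
  push_cast
  field_simp
end

section
/- For all complex x, y of sufficiently small modulus (e.g. |x| < 1/8 and |y| < 1), the double series ∑_{n≥0} ∑_{k≥0} C(n,k)² x^n y^k converges absolutely and equals (1 − 2x(1+y) + x²(1−y)²)^{−1/2}, where the square root is the principal branch. -/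
open Polynomial in
/-- The polynomial `∑ₖ C(n,k)² Xᵏ`. -/
noncomputable def chooseSqPoly (n : ℕ) : ℂ[X] :=
  ∑ k ∈ Finset.range (n + 1), C ((n.choose k : ℂ) ^ 2) * X ^ k

lemma coeff_chooseSqPoly (n k : ℕ) : (chooseSqPoly n).coeff k = (n.choose k : ℂ) ^ 2 := by
  simp only [chooseSqPoly, Polynomial.finsetSum_coeff, Polynomial.coeff_C_mul,
    Polynomial.coeff_X_pow, mul_ite, mul_one, mul_zero, Finset.sum_ite_eq, Finset.mem_range]
  split_ifs with h
  · rfl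
  · simp [Nat.choose_eq_zero_of_lt (by lia : n < k)]

lemma eval_chooseSqPoly (n : ℕ) (y : ℂ) :
    (chooseSqPoly n).eval y = ∑ k ∈ Finset.range (n + 1), (n.choose k : ℂ) ^ 2 * y ^ k := by
  simp [chooseSqPoly, Polynomial.eval_finsetSum]

lemma cast_choose_succ_mul (n k : ℕ) :
    (n.choose (k + 1) : ℂ) * (k + 1) = n.choose k * (n - k) := by
  rcases le_or_gt k n with h | h
  · have := Nat.choose_succ_right_eq n k
    rw [← Nat.cast_sub h]
    exact_mod_cast this
  · simp [Nat.choose_eq_zero_of_lt h, Nat.choose_eq_zero_of_lt (h.trans (Nat.lt_succ_self k))]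

open Polynomial in
lemma chooseSqPoly_recurrence (n : ℕ) :
    C ((n : ℂ) + 2) * chooseSqPoly (n + 2) =
      C (2 * (n : ℂ) + 3) * ((1 + X) * chooseSqPoly (n + 1)) -
        C ((n : ℂ) + 1) * ((1 - X) ^ 2 * chooseSqPoly n) := by
  ext k
  rcases k with _ | _ | k
  · simp only [coeff_sub, mul_coeff_zero, coeff_chooseSqPoly]
    simp [pow_two, mul_coeff_zero]
    ring
  · simp only [coeff_C_mul, coeff_sub, sub_sq, sub_mul, add_mul, coeff_add, one_mul, mul_assoc,
      one_pow, mul_one, zero_add, coeff_X_pow_mul', coeff_chooseSqPoly, coeff_X_mul,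
      coeff_ofNat_mul]
    simp
    ring
  · simp only [coeff_C_mul, coeff_sub, sub_sq, sub_mul, add_mul, coeff_add, one_mul, mul_assoc,
      one_pow, mul_one, coeff_X_pow_mul', coeff_chooseSqPoly, coeff_X_mul, coeff_ofNat_mul,
      Nat.choose_succ_succ', le_add_iff_nonneg_left, zero_le, if_true]
    have h₁ := cast_choose_succ_mul n k
    have h₂ := cast_choose_succ_mul n (k + 1)
    push_cast at h₂ ⊢
    set a : ℂ := (n.choose (k + 1 + 1) : ℂ)
    set b : ℂ := (n.choose (k + 1) : ℂ)
    set c : ℂ := (n.choose k : ℂ)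
    linear_combination 2 * (c + b) * h₂ - 2 * (a + b) * h₁

lemma sum_norm_choose_sq_mul_pow_le (n : ℕ) {y : ℂ} (hy : ‖y‖ ≤ 1) :
    ∑ k ∈ Finset.range (n + 1), ‖(n.choose k : ℂ) ^ 2 * y ^ k‖ ≤ 4 ^ n := by
  calc ∑ k ∈ Finset.range (n + 1), ‖(n.choose k : ℂ) ^ 2 * y ^ k‖
      ≤ ∑ k ∈ Finset.range (n + 1), (n.choose k : ℝ) ^ 2 := by
        refine Finset.sum_le_sum fun k _ => ?_
        rw [norm_mul, norm_pow, norm_pow, Complex.norm_natCast]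
        exact mul_le_of_le_one_right (by positivity) (pow_le_one₀ (norm_nonneg y) hy)
    _ ≤ (∑ k ∈ Finset.range (n + 1), (n.choose k : ℝ)) ^ 2 :=
        Finset.sum_sq_le_sq_sum_of_nonneg fun _ _ => by positivity
    _ = 4 ^ n := by
        have h : ∑ k ∈ Finset.range (n + 1), (n.choose k : ℝ) = 2 ^ n := by
          exact_mod_cast Nat.sum_range_choose n
        rw [h, ← pow_mul, mul_comm n 2, pow_mul]
        norm_num

section PowerSeries

variable {a : ℕ → ℂ}

lemma summable_norm_mul_pow (ha : ∀ n, ‖a n‖ ≤ 4 ^ n) {x : ℂ} (hx : ‖x‖ < 1 / 8) :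
    Summable fun n => ‖a n * x ^ n‖ := by
  refine .of_nonneg_of_le (fun _ => norm_nonneg _) (fun n => ?_)
    (summable_geometric_of_lt_one (r := (1 / 2 : ℝ)) (by norm_num) (by norm_num))
  calc ‖a n * x ^ n‖ = ‖a n‖ * ‖x‖ ^ n := by rw [norm_mul, norm_pow]
    _ ≤ 4 ^ n * (1 / 8) ^ n := by gcongr; exact ha n
    _ = (1 / 2) ^ n := by rw [← mul_pow]; norm_num

lemma norm_natCast_mul_pow_le (ha : ∀ n, ‖a n‖ ≤ 4 ^ n) {x : ℂ} (hx : ‖x‖ < 1 / 8) (n : ℕ) :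
    ‖a n * (n * x ^ (n - 1))‖ ≤ 8 * ((n : ℝ) ^ 1 * (1 / 2) ^ n) := by
  rcases n with _ | n
  · simp
  · calc ‖a (n + 1) * ((n + 1 : ℕ) * x ^ (n + 1 - 1))‖
        = ‖a (n + 1)‖ * ((n + 1 : ℕ) * ‖x‖ ^ n) := by
          rw [norm_mul, norm_mul, norm_pow, Complex.norm_natCast, Nat.add_sub_cancel]
      _ ≤ 4 ^ (n + 1) * ((n + 1 : ℕ) * (1 / 8) ^ n) := by gcongr; exact ha _
      _ = 8 * (((n + 1 : ℕ) : ℝ) ^ 1 * (1 / 2) ^ (n + 1)) := by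
          have h : (1 / 2 : ℝ) ^ n = 4 ^ n * (1 / 8) ^ n := by rw [← mul_pow]; norm_num
          rw [pow_succ (1 / 2 : ℝ), h]
          ring

lemma summable_eight_mul_natCast_mul_geometric :
    Summable fun n : ℕ => 8 * ((n : ℝ) ^ 1 * (1 / 2) ^ n) :=
  by
  have h : ‖(1 / 2 : ℝ)‖ < 1 := by norm_num
  exact (summable_pow_mul_geometric_of_norm_lt_one 1 h).mul_left 8

lemma hasDerivAt_tsum_mul_pow (ha : ∀ n, ‖a n‖ ≤ 4 ^ n) {x : ℂ} (hx : ‖x‖ < 1 / 8) :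
    HasDerivAt (fun z => ∑' n, a n * z ^ n) (∑' n, a n * (n * x ^ (n - 1))) x := by
  refine hasDerivAt_tsum_of_isPreconnected (t := Metric.ball 0 (1 / 8)) (y₀ := x)
    summable_eight_mul_natCast_mul_geometric
    Metric.isOpen_ball (convex_ball _ _).isPreconnected
    (fun n z _ => (hasDerivAt_pow n z).const_mul (a n))
    (fun n z hz => norm_natCast_mul_pow_le ha (by simpa using hz) n) ?_ ?_ ?_
  · simpa using hx
  · exact (summable_norm_mul_pow ha hx).of_norm
  · simpa using hx

lemma tsum_mul_pow_ode (ha : ∀ n, ‖a n‖ ≤ 4 ^ n) {b c : ℂ} (h0 : a 0 = 1) (h1 : a 1 = b)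
    (hrec : ∀ n : ℕ, (n + 2) * a (n + 2) = (2 * n + 3) * b * a (n + 1) - (n + 1) * c * a n)
    {x : ℂ} (hx : ‖x‖ < 1 / 8) :
    (1 - 2 * x * b + x ^ 2 * c) * ∑' n, a n * (n * x ^ (n - 1)) =
      (b - c * x) * ∑' n, a n * x ^ n := by
  have hF := (summable_norm_mul_pow ha hx).of_norm.hasSum
  have hG : Summable fun n : ℕ => a n * (n * x ^ (n - 1)) :=
    .of_norm_bounded summable_eight_mul_natCast_mul_geometric (norm_natCast_mul_pow_le ha hx)
  have hG := hG.hasSum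
  set F := ∑' n, a n * x ^ n
  set G := ∑' n, a n * (n * x ^ (n - 1))
  have hF₁ := (hasSum_nat_add_iff' 1).2 hF
  have hG₁ := (hasSum_nat_add_iff' 1).2 hG
  have hG₂ := (hasSum_nat_add_iff' 2).2 hG
  have hxG : HasSum (fun n : ℕ => n * a n * x ^ n) (x * G) := by
    refine (hG.mul_left x).congr_fun fun n => ?_
    rcases n with _ | n
    · simp
    · rw [Nat.add_sub_cancel]; ring
  simp only [Finset.sum_range_succ, Finset.sum_range_zero, h0, h1] at hF₁ hG₁ hG₂
  have key := hG₂.unique ((((hG₁.mul_left (2 * x)).add hF₁).mul_left b).sub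
    ((hxG.add hF).mul_left (c * x)) |>.congr_fun fun n => ?_)
  · norm_num at key
    linear_combination key
  · have := hrec n
    simp only [Nat.add_sub_cancel, show n + 2 - 1 = n + 1 by lia]
    push_cast
    linear_combination x ^ (n + 1) * this

lemma tsum_mul_pow_eq_cpow (ha : ∀ n, ‖a n‖ ≤ 4 ^ n) {b c : ℂ} (h0 : a 0 = 1) (h1 : a 1 = b)
    (hrec : ∀ n : ℕ, (n + 2) * a (n + 2) = (2 * n + 3) * b * a (n + 1) - (n + 1) * c * a n)
    (hD : ∀ z : ℂ, ‖z‖ < 1 / 8 → 1 - 2 * z * b + z ^ 2 * c ∈ Complex.slitPlane)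
    {x : ℂ} (hx : ‖x‖ < 1 / 8) :
    ∑' n, a n * x ^ n = (1 - 2 * x * b + x ^ 2 * c) ^ (-(1 / 2) : ℂ) := by
  set D : ℂ → ℂ := fun z => 1 - 2 * z * b + z ^ 2 * c with hDdef
  have hderiv : ∀ z ∈ Metric.ball (0 : ℂ) (1 / 8),
      HasDerivAt (fun z => (∑' n, a n * z ^ n) * D z ^ (1 / 2 : ℂ)) 0 z := by
    intro z hz
    rw [mem_ball_zero_iff] at hz
    have hDz : HasDerivAt D (-(2 * b) + 2 * z * c) z := by
      have h₁ := ((hasDerivAt_id z).const_mul 2).mul_const b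
      have h₂ := (hasDerivAt_pow 2 z).mul_const c
      refine ((h₁.const_sub 1).add h₂).congr_deriv ?_
      norm_num
    refine ((hasDerivAt_tsum_mul_pow ha hz).mul
      (hDz.cpow_const (c := 1 / 2) (hD z hz))).congr_deriv ?_
    have hne : D z ≠ 0 := Complex.slitPlane_ne_zero (hD z hz)
    have hode : D z * ∑' n, a n * (n * z ^ (n - 1)) = (b - c * z) * ∑' n, a n * z ^ n :=
      tsum_mul_pow_ode ha h0 h1 hrec hz
    rw [Complex.cpow_sub _ _ hne, Complex.cpow_one]
    clear_value D
    generalize ∑' n, a n * (n * z ^ (n - 1)) = G at hode ⊢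
    field_simp
    linear_combination D z ^ (1 / 2 : ℂ) * hode
  have hconst := Metric.isOpen_ball.is_const_of_deriv_eq_zero
    (convex_ball (0 : ℂ) (1 / 8)).isPreconnected
    (fun z hz => (hderiv z hz).differentiableAt.differentiableWithinAt)
    (fun z hz => (hderiv z hz).deriv)
    (mem_ball_zero_iff.2 hx) (Metric.mem_ball_self (by norm_num))
  have hzero : ∑' n, a n * (0 : ℂ) ^ n = 1 := by
    rw [tsum_eq_single 0 fun n hn => by simp [hn]]
    simp [h0]
  have hone : (∑' n, a n * x ^ n) * D x ^ (1 / 2 : ℂ) = 1 := by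
    rw [hconst, hzero]
    simp [hDdef]
  rw [Complex.cpow_neg]
  exact eq_inv_of_mul_eq_one_left hone

end PowerSeries

lemma one_sub_add_mem_slitPlane {x y : ℂ} (hx : ‖x‖ < 1 / 8) (hy : ‖y‖ < 1) :
    1 - 2 * x * (1 + y) + x ^ 2 * (1 - y) ^ 2 ∈ Complex.slitPlane := by
  rw [show 1 - 2 * x * (1 + y) + x ^ 2 * (1 - y) ^ 2 =
    1 + (x ^ 2 * (1 - y) ^ 2 - 2 * x * (1 + y)) by ring]
  apply Complex.mem_slitPlane_of_norm_lt_one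
  have h₁ : ‖1 + y‖ ≤ 2 := by
    have := norm_add_le 1 y
    rw [norm_one] at this
    linarith
  have h₂ : ‖1 - y‖ ≤ 2 := by
    have := norm_sub_le 1 y
    rw [norm_one] at this
    linarith
  calc ‖x ^ 2 * (1 - y) ^ 2 - 2 * x * (1 + y)‖
      ≤ ‖x ^ 2 * (1 - y) ^ 2‖ + ‖2 * x * (1 + y)‖ := norm_sub_le _ _
    _ = ‖x‖ ^ 2 * ‖1 - y‖ ^ 2 + 2 * ‖x‖ * ‖1 + y‖ := by simp
    _ ≤ (1 / 8) ^ 2 * 2 ^ 2 + 2 * (1 / 8) * 2 := by gcongr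
    _ < 1 := by norm_num

lemma choose_sq_mul_eq_zero {n k : ℕ} (hk : k ∉ Finset.range (n + 1)) (x y : ℂ) :
    (n.choose k : ℂ) ^ 2 * x ^ n * y ^ k = 0 := by
  simp [Nat.choose_eq_zero_of_lt (by simpa using hk : n < k)]

lemma tsum_choose_sq_mul (n : ℕ) (x y : ℂ) :
    ∑' k, (n.choose k : ℂ) ^ 2 * x ^ n * y ^ k = (chooseSqPoly n).eval y * x ^ n := by
  rw [tsum_eq_sum fun k hk => choose_sq_mul_eq_zero hk x y, eval_chooseSqPoly, Finset.sum_mul]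
  exact Finset.sum_congr rfl fun k _ => by ring

lemma summable_norm_choose_sq_mul {x y : ℂ} (hx : ‖x‖ < 1 / 8) (hy : ‖y‖ ≤ 1) :
    Summable fun p : ℕ × ℕ => ‖(p.1.choose p.2 : ℂ) ^ 2 * x ^ p.1 * y ^ p.2‖ := by
  have hzero (n k : ℕ) (hk : k ∉ Finset.range (n + 1)) :
      ‖(n.choose k : ℂ) ^ 2 * x ^ n * y ^ k‖ = 0 := by
    rw [choose_sq_mul_eq_zero hk, norm_zero]
  refine (summable_prod_of_nonneg fun _ => norm_nonneg _).2
    ⟨fun n => summable_of_ne_finset_zero (hzero n), ?_⟩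
  have h4 : ∀ n : ℕ, ‖((4 : ℂ) ^ n)‖ ≤ 4 ^ n := fun n => by simp
  refine .of_nonneg_of_le (fun n => tsum_nonneg fun _ => norm_nonneg _) (fun n => ?_)
    (summable_norm_mul_pow h4 hx)
  rw [tsum_eq_sum (hzero n)]
  calc ∑ k ∈ Finset.range (n + 1), ‖(n.choose k : ℂ) ^ 2 * x ^ n * y ^ k‖
      = (∑ k ∈ Finset.range (n + 1), ‖(n.choose k : ℂ) ^ 2 * y ^ k‖) * ‖x‖ ^ n := by
        rw [Finset.sum_mul]
        exact Finset.sum_congr rfl fun k _ => by simp only [norm_mul, norm_pow]; ring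
    _ ≤ 4 ^ n * ‖x‖ ^ n := by gcongr; exact sum_norm_choose_sq_mul_pow_le n hy
    _ = ‖(4 : ℂ) ^ n * x ^ n‖ := by simp


/-- **Two-variable generating function of the squared binomial coefficients**:
for `|x| < 1/8` and `|y| < 1`, the double series `∑_{n,k≥0} C(n,k)² xⁿ yᵏ`
converges absolutely and equals `(1 - 2x(1+y) + x²(1-y)²)^{-1/2}` with the
principal branch of the square root. -/
theorem central_binomial_sq_gf (x y : ℂ) (hx : ‖x‖ < 1 / 8) (hy : ‖y‖ < 1) :
    (Summable fun p : ℕ × ℕ =>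
      ‖(Nat.choose p.1 p.2 : ℂ) ^ 2 * x ^ p.1 * y ^ p.2‖) ∧
    ∑' p : ℕ × ℕ, (Nat.choose p.1 p.2 : ℂ) ^ 2 * x ^ p.1 * y ^ p.2 =
      (1 - 2 * x * (1 + y) + x ^ 2 * (1 - y) ^ 2) ^ (-(1 / 2) : ℂ) := by
  have hsum := summable_norm_choose_sq_mul hx hy.le
  refine ⟨hsum, ?_⟩
  rw [hsum.of_norm.tsum_prod]
  simp only [tsum_choose_sq_mul]
  refine tsum_mul_pow_eq_cpow (a := fun n => (chooseSqPoly n).eval y) (fun n => ?_) ?_ ?_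
    (fun n => ?_) (fun z hz => one_sub_add_mem_slitPlane hz hy) hx
  · rw [eval_chooseSqPoly]
    exact (norm_sum_le _ _).trans (sum_norm_choose_sq_mul_pow_le n hy.le)
  · simp [eval_chooseSqPoly]
  · simp [eval_chooseSqPoly, Finset.sum_range_succ]
  · have h := congrArg (Polynomial.eval y) (chooseSqPoly_recurrence n)
    simp only [Polynomial.eval_mul, Polynomial.eval_sub, Polynomial.eval_add, Polynomial.eval_pow,
      Polynomial.eval_C, Polynomial.eval_X, Polynomial.eval_one] at h
    linear_combination h
end
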